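/- Suppose the family (K i) has at most three maxsets. Then for every nonempty collection S of maxsets of (K i) there exists a priority ordering P such that the maxsets minimal with respect to P are exactly the members of S. -/

import Mathlib

/-- The models of a set `M` of formula indices: the interpretations satisfying
`K i` for every `i ∈ M`. -/
def KMod {V ι : Type*} (K : ι → Set (V → Bool)) (M : Set ι) : Set (V → Bool) :=
  {I | ∀ i ∈ M, I ∈ K i}

/-- A set of formula indices is consistent if it has a model. -/
def ConsistentSet {V ι : Type*} (K : ι → Set (V → Bool)) (M : Set ι) : Prop :=
  (KMod K M).Nonempty

/-- A maxset: a maximally consistent subset of the family. -/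
def Maxset {V ι : Type*} (K : ι → Set (V → Bool)) (M : Set ι) : Prop :=
  ConsistentSet K M ∧ ∀ j ∉ M, ¬ ConsistentSet K (M ∪ {j})

/-- A priority ordering: every formula is in some class `≥ 1`, and the first
class is nonempty. -/
def PriorityOrdering {ι : Type*} (P : ι → ℕ) : Prop :=
  (∀ i, 1 ≤ P i) ∧ (∃ i, P i = 1)

/-- The comparison of sets of formulae induced by a priority ordering `P`. -/
def PLt {ι : Type*} (P : ι → ℕ) (M N : Set ι) : Prop :=
  ∃ n, 1 ≤ n ∧ (∀ m, 1 ≤ m → m < n → {i ∈ M | P i = m} = {i ∈ N | P i = m}) ∧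
    {i ∈ N | P i = n} ⊂ {i ∈ M | P i = n}

/-- A maxset is minimal w.r.t. `P` when no consistent set is below it. -/
def MinimalMaxset {V ι : Type*} (K : ι → Set (V → Bool)) (P : ι → ℕ)
    (M : Set ι) : Prop :=
  Maxset K M ∧ ¬ ∃ N : Set ι, ConsistentSet K N ∧ PLt P N M

/-- The result of merging the family `K` under the priority ordering `P`:
the union of the models of the minimal maxsets. -/
def MergeResult {V ι : Type*} (K : ι → Set (V → Bool)) (P : ι → ℕ) :
    Set (V → Bool) :=
  ⋃ M ∈ {M : Set ι | MinimalMaxset K P M}, KMod K M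

theorem ConsistentSet.mono {V ι : Type*} {K : ι → Set (V → Bool)} {M N : Set ι}
    (hN : ConsistentSet K N) (h : M ⊆ N) : ConsistentSet K M :=
  hN.imp fun _ hI i hi => hI i (h hi)

theorem Maxset.eq_of_subset {V ι : Type*} {K : ι → Set (V → Bool)} {M N : Set ι}
    (hM : Maxset K M) (hN : ConsistentSet K N) (h : M ⊆ N) : M = N := by
  refine h.antisymm fun j hj => ?_
  by_contra hjM
  exact hM.2 j hjM (hN.mono (Set.union_subset h (Set.singleton_subset_iff.2 hj)))

theorem ConsistentSet.exists_maxset_superset {V ι : Type*} [Finite ι] {K : ι → Set (V → Bool)}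
    {N : Set ι} (hN : ConsistentSet K N) : ∃ M, Maxset K M ∧ N ⊆ M := by
  obtain ⟨M, hNM, hM⟩ := (Set.toFinite {M : Set ι | ConsistentSet K M}).exists_le_maximal hN
  refine ⟨M, ⟨hM.prop, fun j hj hc => hj ?_⟩, hNM⟩
  exact hM.le_of_ge hc Set.subset_union_left (Or.inr rfl)

theorem Maxset.nonempty {V ι : Type*} [Nonempty ι] {K : ι → Set (V → Bool)} {M : Set ι}
    (hK : ∀ i, (K i).Nonempty) (hM : Maxset K M) : M.Nonempty := by
  rw [Set.nonempty_iff_ne_empty]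
  rintro rfl
  obtain ⟨j⟩ := ‹Nonempty ι›
  obtain ⟨I, hI⟩ := hK j
  exact hM.2 j (Set.notMem_empty j) ⟨I, by simpa [KMod] using hI⟩

open Classical in
/-- The ordering with first class `X` and second class the complement of `X`. -/
noncomputable def twoClass {ι : Type*} (X : Set ι) (i : ι) : ℕ := if i ∈ X then 1 else 2

theorem sep_twoClass_eq_one {ι : Type*} (X M : Set ι) : {i ∈ M | twoClass X i = 1} = M ∩ X := by
  ext i
  by_cases hi : i ∈ X <;> simp [twoClass, hi]

theorem pLt_twoClass_of_ssubset {ι : Type*} {X M N : Set ι} (h : M ∩ X ⊂ N ∩ X) :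
    PLt (twoClass X) N M :=
  ⟨1, le_rfl, fun m _ _ => by omega, by rwa [sep_twoClass_eq_one, sep_twoClass_eq_one]⟩

theorem PLt.ssubset_or_subset_of_twoClass {ι : Type*} {X M N : Set ι}
    (h : PLt (twoClass X) N M) : M ∩ X ⊂ N ∩ X ∨ M ⊂ N := by
  obtain ⟨n, hn, heq, hlt⟩ := h
  obtain rfl | hn1 := hn.eq_or_lt
  · left
    rwa [sep_twoClass_eq_one, sep_twoClass_eq_one] at hlt
  · right
    have h1 := heq 1 le_rfl hn1
    rw [sep_twoClass_eq_one, sep_twoClass_eq_one] at h1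
    obtain ⟨i, ⟨hiN, hin⟩, hiM⟩ := Set.exists_of_ssubset hlt
    have hn2 : n = 2 := by
      unfold twoClass at hin
      split_ifs at hin <;> omega
    refine ⟨fun j hj => ?_, fun hsub => hiM ⟨hsub hiN, hin⟩⟩
    by_cases hjX : j ∈ X
    · exact (h1.ge ⟨hj, hjX⟩).1
    · exact (hlt.1 ⟨hj, by simp [twoClass, hjX, hn2]⟩).1

theorem minimalMaxset_twoClass_iff {V ι : Type*} [Finite ι] {K : ι → Set (V → Bool)}
    {X M : Set ι} (hM : Maxset K M) :
    MinimalMaxset K (twoClass X) M ↔ ∀ N, Maxset K N → ¬ M ∩ X ⊂ N ∩ X := by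
  refine ⟨fun h N hN hlt => h.2 ⟨N, hN.1, pLt_twoClass_of_ssubset hlt⟩, fun h => ⟨hM, ?_⟩⟩
  rintro ⟨N, hN, hlt⟩
  obtain hX | hsub := hlt.ssubset_or_subset_of_twoClass
  · obtain ⟨N', hN', hNN'⟩ := hN.exists_maxset_superset
    exact h N' hN' (hX.trans_subset (Set.inter_subset_inter_left X hNN'))
  · exact hsub.ne (hM.eq_of_subset hN hsub.1)

theorem exists_priorityOrdering_of_class {V ι : Type*} [Finite ι] {K : ι → Set (V → Bool)}
    {S : Set (Set ι)} (hS : ∀ M ∈ S, Maxset K M) {X : Set ι} (hX : X.Nonempty)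
    (hmin : ∀ M ∈ S, ∀ N, Maxset K N → ¬ M ∩ X ⊂ N ∩ X)
    (hout : ∀ M, Maxset K M → M ∉ S → ∃ N, Maxset K N ∧ M ∩ X ⊂ N ∩ X) :
    ∃ P : ι → ℕ, PriorityOrdering P ∧ {M : Set ι | MinimalMaxset K P M} = S := by
  obtain ⟨x, hx⟩ := hX
  refine ⟨twoClass X, ⟨fun i => ?_, x, by simp [twoClass, hx]⟩, ?_⟩
  · unfold twoClass
    split_ifs <;> omega
  · ext M
    refine ⟨fun h => ?_, fun h => (minimalMaxset_twoClass_iff (hS M h)).2 (hmin M h)⟩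
    by_contra hMS
    obtain ⟨N, hN, hlt⟩ := hout M h.1 hMS
    exact (minimalMaxset_twoClass_iff h.1).1 h N hN hlt

/-- Among three sets with `A` and `B` not contained in `C`, some first class separates `C` from the
other two while keeping `A` and `B` unbeaten. -/
theorem exists_class_of_three {ι : Type*} {A B C : Set ι}
    (hAC : ¬ A ⊆ C) (hBC : ¬ B ⊆ C) :
    ∃ X : Set ι, X.Nonempty ∧ ¬ A ∩ X ⊂ B ∩ X ∧ ¬ B ∩ X ⊂ A ∩ X ∧ C ∩ X ⊂ A ∩ X ∧
      ¬ B ∩ X ⊂ C ∩ X := by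
  by_cases h : A ∩ B ⊆ C
  · obtain ⟨a, haA, haC⟩ := Set.not_subset.1 hAC
    obtain ⟨b, hbB, hbC⟩ := Set.not_subset.1 hBC
    have haB : a ∉ B := fun haB => haC (h ⟨haA, haB⟩)
    have hbA : b ∉ A := fun hbA => hbC (h ⟨hbA, hbB⟩)
    have haX : a ∈ (A ∪ B) \ C := ⟨Or.inl haA, haC⟩
    have hbX : b ∈ (A ∪ B) \ C := ⟨Or.inr hbB, hbC⟩
    refine ⟨(A ∪ B) \ C, ⟨a, haX⟩, fun hs => haB (hs.1 ⟨haA, haX⟩).1,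
      fun hs => hbA (hs.1 ⟨hbB, hbX⟩).1, ⟨fun i hi => absurd hi.1 hi.2.2,
      fun hs => haC (hs ⟨haA, haX⟩).1⟩, fun hs => hbC (hs.1 ⟨hbB, hbX⟩).1⟩
  · obtain ⟨x, hx, hxC⟩ := Set.not_subset.1 h
    refine ⟨A ∩ B, ⟨x, hx⟩, fun hs => hs.2 fun i hi => ⟨hi.2.1, hi.2⟩,
      fun hs => hs.2 fun i hi => ⟨hi.2.2, hi.2⟩, ⟨fun i hi => ⟨hi.2.1, hi.2⟩,
      fun hs => hxC (hs ⟨hx.1, hx⟩).1⟩, fun hs => hxC (hs.1 ⟨hx.2, hx⟩).1⟩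

theorem stmt_13 {V ι : Type*} [Fintype V] [Fintype ι] [Nonempty ι]
    (K : ι → Set (V → Bool)) (hK : ∀ i, (K i).Nonempty)
    (h3 : {M : Set ι | Maxset K M}.ncard ≤ 3) :
    ∀ S : Set (Set ι), S.Nonempty → (∀ M ∈ S, Maxset K M) →
      ∃ P : ι → ℕ, PriorityOrdering P ∧
        {M : Set ι | MinimalMaxset K P M} = S := by
  intro S hSne hS
  have hanti : ∀ {M N : Set ι}, Maxset K M → Maxset K N → M ≠ N → ¬ M ⊆ N :=
    fun hM hN hne h => hne (hM.eq_of_subset hN.1 h)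
  by_cases hall : ∀ M, Maxset K M → M ∈ S
  · refine exists_priorityOrdering_of_class hS Set.univ_nonempty (fun M hM N hN hlt => ?_)
      fun M hM hMS => absurd (hall M hM) hMS
    simp only [Set.inter_univ] at hlt
    exact hanti (hS M hM) hN hlt.ne hlt.1
  push Not at hall
  obtain ⟨C, hC, hCS⟩ := hall
  have hins : insert C S ⊆ {M : Set ι | Maxset K M} := Set.insert_subset hC hS
  have hcard := Set.ncard_insert_of_notMem hCS (Set.toFinite S)
  have hle := Set.ncard_le_ncard hins (Set.toFinite _)
  obtain ⟨A, hAS⟩ := hSne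
  have hA := hS A hAS
  by_cases hsub : ∀ M ∈ S, M = A
  · refine exists_priorityOrdering_of_class hS (hA.nonempty hK) (fun M hM N hN hlt => ?_)
      fun M hM hMS => ⟨A, hA, fun i hi => ⟨hi.2, hi.2⟩, fun hs => ?_⟩
    · obtain rfl := hsub M hM
      exact hlt.2 fun i hi => ⟨hi.2, hi.2⟩
    · exact hanti hA hM (fun h => hMS (h ▸ hAS)) fun i hi => (hs ⟨hi, hi⟩).1
  push Not at hsub
  obtain ⟨B, hBS, hBA⟩ := hsub
  have hB := hS B hBS
  have hpair : ({A, B} : Set (Set ι)).ncard = 2 := Set.ncard_pair hBA.symm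
  have hSpair : {A, B} = S :=
    Set.eq_of_subset_of_ncard_le (Set.pair_subset hAS hBS) (by omega) (Set.toFinite S)
  have hmax : insert C S = {M : Set ι | Maxset K M} :=
    Set.eq_of_subset_of_ncard_le hins (by rw [hcard, ← hSpair, hpair]; exact h3) (Set.toFinite _)
  have hcases : ∀ N, Maxset K N → N = C ∨ N = A ∨ N = B := fun N hN => by
    have : N ∈ insert C S := hmax ▸ hN
    simpa [← hSpair] using this
  have hCA : C ≠ A := fun h => hCS (h ▸ hAS)
  have hCB : C ≠ B := fun h => hCS (h ▸ hBS)
  obtain ⟨X, hX, h1, h2, h3, h4⟩ := exists_class_of_three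
    (hanti hA hC hCA.symm) (hanti hB hC hCB.symm)
  refine exists_priorityOrdering_of_class hS hX (fun M hM N hN => ?_) fun M hM hMS => ?_
  · rw [← hSpair] at hM
    obtain rfl | rfl := hM <;> obtain rfl | rfl | rfl := hcases N hN
    exacts [h3.asymm, ssubset_irrefl _, h1, h4, h2, ssubset_irrefl _]
  · obtain rfl | rfl | rfl := hcases M hM
    exacts [⟨A, hA, h3⟩, absurd hAS hMS, absurd hBS hMS]
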